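/- For every integer r ≥ 3 there exists a quasi-linear, inconsistent r-graph F which admits all inconsistent descriptive sequences of order r. -/

import Mathlib

namespace UTD

/-- An `r`-uniform hypergraph on a finite vertex set of naturals. -/
structure RGraph (r : ℕ) where
  verts : Finset ℕ
  edges : Finset (Finset ℕ)
  edges_subset : ∀ e ∈ edges, e ⊆ verts
  edges_card : ∀ e ∈ edges, e.card = r

/-- `F` is a subgraph of `H`: an injection of `V(F)` into `V(H)` mapping edges to edges. -/
def IsSubgraph {r : ℕ} (F H : RGraph r) : Prop :=
  ∃ φ : ℕ → ℕ, Set.InjOn φ ↑F.verts ∧ (∀ v ∈ F.verts, φ v ∈ H.verts) ∧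
    ∀ e ∈ F.edges, e.image φ ∈ H.edges

/-- `H` is `(d, ε)`-dense: every `S ⊆ V(H)` with `|S| ≥ ε|V(H)|` spans at least
`(d - ε) * C(|S|, r)` edges. -/
def IsDense {r : ℕ} (H : RGraph r) (d ε : ℝ) : Prop :=
  ∀ S ⊆ H.verts, ε * H.verts.card ≤ S.card →
    (d - ε) * (S.card.choose r : ℝ) ≤ ((H.edges.filter (fun e => e ⊆ S)).card : ℝ)

/-- A sequence of `r`-graphs is locally `d`-dense. -/
def LocallyDense {r : ℕ} (H : ℕ → RGraph r) (d : ℝ) : Prop :=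
  ∃ ε : ℕ → ℝ, (∀ n, 0 < ε n) ∧
    Filter.Tendsto ε Filter.atTop (nhds 0) ∧
    Filter.Tendsto (fun n => (H n).verts.card) Filter.atTop Filter.atTop ∧
    ∀ n, IsDense (H n) d (ε n)

/-- The role (set of ranks, 1-indexed) that the elements of `p` play within the
set `e`, with respect to the order given by `ord`. -/
def role (ord : ℕ → ℕ) (e p : Finset ℕ) : Finset ℕ :=
  p.image (fun v => (e.filter (fun w => ord w < ord v)).card + 1)

/-- Twin pair of edges: distinct edges intersecting in exactly two vertices. -/
def IsTwin {r : ℕ} (F : RGraph r) (e f : Finset ℕ) : Prop :=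
  e ∈ F.edges ∧ f ∈ F.edges ∧ e ≠ f ∧ (e ∩ f).card = 2

/-- Quasi-linear: every edge `e` has a unique twin, and all other edges meet `e`
in at most one vertex. -/
def QuasiLinear {r : ℕ} (F : RGraph r) : Prop :=
  ∀ e ∈ F.edges, ∃ f ∈ F.edges, f ≠ e ∧ (e ∩ f).card = 2 ∧
    ∀ f' ∈ F.edges, f' ≠ e → f' ≠ f → (e ∩ f').card ≤ 1

/-- `F` with the vertex order `ord` is consistently ordered. -/
def ConsistentlyOrdered {r : ℕ} (F : RGraph r) (ord : ℕ → ℕ) : Prop :=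
  ∀ e f, IsTwin F e f → role ord e (e ∩ f) = role ord f (e ∩ f)

/-- `F` is consistent: some linear order of its vertices makes it consistently ordered. -/
def Consistent {r : ℕ} (F : RGraph r) : Prop :=
  ∃ ord : ℕ → ℕ, Set.InjOn ord ↑F.verts ∧ ConsistentlyOrdered F ord

/-- `p` is the head of the edge `e`: its two smallest vertices w.r.t. `ord`. -/
def IsHead (ord : ℕ → ℕ) (e p : Finset ℕ) : Prop :=
  p ⊆ e ∧ p.card = 2 ∧ ∀ u ∈ p, ∀ w ∈ e, w ∉ p → ord u < ord w

/-- `p` is the tail of the edge `e`: its two largest vertices w.r.t. `ord`. -/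
def IsTail (ord : ℕ → ℕ) (e p : Finset ℕ) : Prop :=
  p ⊆ e ∧ p.card = 2 ∧ ∀ u ∈ p, ∀ w ∈ e, w ∉ p → ord w < ord u

/-- Head-tail-mixing: for every linear order of the vertex set there are edges
`e, f` such that the head of `e` equals the tail of `f`. -/
def HeadTailMixing {r : ℕ} (F : RGraph r) : Prop :=
  ∀ ord : ℕ → ℕ, Set.InjOn ord ↑F.verts →
    ∃ e ∈ F.edges, ∃ f ∈ F.edges, ∃ p : Finset ℕ, IsHead ord e p ∧ IsTail ord f p

inductive Letter : Type
  | X | Y | Z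
  deriving DecidableEq

/-- A descriptive sequence of order `r`: `2r - 2` letters, among which `r - 2`
are `X`, `r - 2` are `Y`, and two are `Z`. -/
def IsDescSeq (r : ℕ) (σ : Fin (2 * r - 2) → Letter) : Prop :=
  (Finset.univ.filter (fun i => σ i = Letter.X)).card = r - 2 ∧
  (Finset.univ.filter (fun i => σ i = Letter.Y)).card = r - 2 ∧
  (Finset.univ.filter (fun i => σ i = Letter.Z)).card = 2

/-- The descriptive sequence `XX…XZZYY…Y`. -/
def headTailSeq (r : ℕ) : Fin (2 * r - 2) → Letter := fun i =>
  if (i : ℕ) < r - 2 then Letter.X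
  else if (i : ℕ) < r then Letter.Z
  else Letter.Y

/-- The role (set of ranks, 1-indexed) played by the positions of the two `Z`s
within the positions carrying letters different from `avoid`. -/
def seqRole (r : ℕ) (σ : Fin (2 * r - 2) → Letter) (avoid : Letter) : Finset ℕ :=
  (Finset.univ.filter (fun i => σ i = Letter.Z)).image
    (fun i => (Finset.univ.filter (fun j => σ j ≠ avoid ∧ j < i)).card + 1)

/-- A descriptive sequence is consistent if its two `Z`s play the same role among
the `X/Z` positions as among the `Y/Z` positions. -/
def SeqConsistent (r : ℕ) (σ : Fin (2 * r - 2) → Letter) : Prop :=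
  seqRole r σ Letter.Y = seqRole r σ Letter.X

def SeqInconsistent (r : ℕ) (σ : Fin (2 * r - 2) → Letter) : Prop :=
  IsDescSeq r σ ∧ ¬ SeqConsistent r σ

/-- The descriptive sequence `σ` describes the pair of edges `{e, f}` under the
vertex order `ord`. -/
def Describes (r : ℕ) (σ : Fin (2 * r - 2) → Letter) (ord : ℕ → ℕ)
    (e f : Finset ℕ) : Prop :=
  ∃ w : Fin (2 * r - 2) → ℕ,
    (∀ i j : Fin (2 * r - 2), i < j → ord (w i) < ord (w j)) ∧
    (∀ v : ℕ, v ∈ e ∪ f ↔ ∃ i, w i = v) ∧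
    (((∀ i, w i ∈ e ↔ σ i ≠ Letter.Y) ∧ (∀ i, w i ∈ f ↔ σ i ≠ Letter.X)) ∨
     ((∀ i, w i ∈ e ↔ σ i ≠ Letter.X) ∧ (∀ i, w i ∈ f ↔ σ i ≠ Letter.Y)))

/-- A quasi-linear `r`-graph admits the descriptive sequence `σ`: there is a
linear order of its vertices in which every twin pair of edges is described by `σ`. -/
def AdmitsSeq {r : ℕ} (F : RGraph r) (σ : Fin (2 * r - 2) → Letter) : Prop :=
  ∃ ord : ℕ → ℕ, Set.InjOn ord ↑F.verts ∧
    ∀ e f, IsTwin F e f → Describes r σ ord e f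

/-- Linear hypergraph: any two distinct edges intersect in at most one vertex. -/
def LinearGraph {r : ℕ} (H : RGraph r) : Prop :=
  ∀ e ∈ H.edges, ∀ f ∈ H.edges, e ≠ f → (e ∩ f).card ≤ 1

/-- Nowhere-empty sequence of `r`-graphs. -/
def NowhereEmpty {r : ℕ} (H : ℕ → RGraph r) : Prop :=
  ∀ c : ℝ, 0 < c → ∃ n₀ : ℕ, ∀ n ≥ n₀, ∀ S : Fin r → Finset ℕ,
    (∀ i, S i ⊆ (H n).verts) →
    (∀ i j, i ≠ j → Disjoint (S i) (S j)) →
    (∀ i, c * (H n).verts.card ≤ (S i).card) →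
    ∃ e ∈ (H n).edges, ∀ i, (e ∩ S i).Nonempty

/-- A `(k, r)`-reduced hypergraph. -/
structure ReducedGraph (k r : ℕ) where
  part : Fin k → Fin k → Finset ℕ
  part_symm : ∀ i j, part i j = part j i
  part_disj : ∀ i j i' j' : Fin k, i < j → i' < j' → (i, j) ≠ (i', j') →
    Disjoint (part i j) (part i' j')
  edges : Finset (Finset ℕ)
  edges_card : ∀ e ∈ edges, e.card = r.choose 2
  edges_struct : ∀ e ∈ edges, ∃ t : Fin r → Fin k, StrictMono t ∧
    ∀ a b : Fin r, a < b → (e ∩ part (t a) (t b)).card = 1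

/-- The constituent `A_{t 0, …, t (r-1)}` of a reduced hypergraph. -/
def constituent {k r : ℕ} (H : ReducedGraph k r) (t : Fin r → Fin k) :
    Finset (Finset ℕ) :=
  H.edges.filter (fun e => ∀ a b : Fin r, a < b → (e ∩ H.part (t a) (t b)).card = 1)

/-- A reduced hypergraph has density at least `d`. -/
def HasDensity {k r : ℕ} (H : ReducedGraph k r) (d : ℝ) : Prop :=
  ∀ t : Fin r → Fin k, StrictMono t →
    d * ∏ p ∈ Finset.univ.filter (fun p : Fin r × Fin r => p.1 < p.2),
      ((H.part (t p.1) (t p.2)).card : ℝ) ≤ ((constituent H t).card : ℝ)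

/-- The `(2r-2)`-tuple of indices `t` admits the descriptive sequence `σ` in the
reduced hypergraph `H`. -/
def TupleAdmits {k r : ℕ} (H : ReducedGraph k r) (σ : Fin (2 * r - 2) → Letter)
    (t : Fin (2 * r - 2) → Fin k) : Prop :=
  ∃ tx ty : Fin r → Fin k, StrictMono tx ∧ StrictMono ty ∧
    Set.range tx = t '' {i | σ i ≠ Letter.Y} ∧
    Set.range ty = t '' {i | σ i ≠ Letter.X} ∧
    ∃ eX ∈ constituent H tx, ∃ eY ∈ constituent H ty, (eX ∩ eY).card = 1

/-- The uniform Turán density threshold `C(r,2)^(-C(r,2))`. -/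
noncomputable def piR (r : ℕ) : ℝ := ((r.choose 2 : ℝ) ^ (r.choose 2))⁻¹



/-- labels of the vertices of a twin pair: `x i`, `y i`, and the two common vertices -/
abbrev Lab (m : ℕ) := Fin m ⊕ (Fin m ⊕ Bool)
abbrev lx {m : ℕ} (i : Fin m) : Lab m := Sum.inl i
abbrev ly {m : ℕ} (i : Fin m) : Lab m := Sum.inr (Sum.inl i)
abbrev lz {m : ℕ} : Lab m := Sum.inr (Sum.inr true)
abbrev lz' {m : ℕ} : Lab m := Sum.inr (Sum.inr false)

/-- the number of `x`s below `z` differs from the number of `y`s below `z` -/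
def Bad {m : ℕ} (v : Lab m → ℕ) : Prop :=
  (Finset.univ.filter (fun i => v (lx i) < v lz)).card ≠
    (Finset.univ.filter (fun i => v (ly i) < v lz)).card

lemma exch_aux {m : ℕ} (P Q : Fin m → Prop) [DecidablePred P] [DecidablePred Q] (i : Fin m)
    (h : ∀ i', i' ≠ i → (P i' ↔ Q i'))
    (hc : (Finset.univ.filter P).card = (Finset.univ.filter Q).card) (hP : P i) : Q i := by
  by_contra hQ
  have : Finset.univ.filter Q ⊂ Finset.univ.filter P := by
    rw [Finset.ssubset_iff_of_subset]
    · exact ⟨i, by simp [hP], by simp [hQ]⟩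
    · intro a ha
      simp only [Finset.mem_filter, Finset.mem_univ, true_and] at ha ⊢
      by_cases hai : a = i
      · subst hai; exact hP
      · exact (h a hai).2 ha
  have := Finset.card_lt_card this
  omega

lemma exch_aux_sub {m : ℕ} (P Q : Fin m → Prop) [DecidablePred P] [DecidablePred Q]
    (h : ∀ i, Q i → P i)
    (hc : (Finset.univ.filter P).card = (Finset.univ.filter Q).card) (i : Fin m) (hP : P i) :
    Q i := by
  have hs : Finset.univ.filter Q ⊆ Finset.univ.filter P := by
    intro a ha
    simp only [Finset.mem_filter, Finset.mem_univ, true_and] at ha ⊢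
    exact h a ha
  have := Finset.eq_of_subset_of_card_le hs hc.le
  have hi : i ∈ Finset.univ.filter P := by simp [hP]
  rw [← this] at hi
  simpa using hi

set_option maxHeartbeats 1000000 in
lemma base_aux {J : Type} [Fintype J] [Nonempty J] {m : ℕ} (pos : J → Lab m → ℤ) (k : ℤ)
    (h0 : ∀ j l, 0 ≤ pos j l) (hk : ∀ j l, pos j l < k) (hinj : ∀ j, Function.Injective (pos j))
    (i0 : Fin m) (h1 : ∀ j, pos j (lx i0) < pos j lz) (h2 : ∀ j, pos j lz < pos j (ly i0))
    (h3 : ∀ j i, pos j (ly i) < pos j lz → pos j (lx i) < pos j lz)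
    (ord : (J → ℤ) → ℕ) (B : ℤ) (hB : B = k * k + 4 * k)
    (hord : Set.InjOn ord {a | ∀ j, -B ≤ a j ∧ a j ≤ B}) :
    ∃ c : Lab m → J → ℤ, (∀ l j, -B ≤ c l j ∧ c l j ≤ B) ∧
      (∀ j l l', pos j l < pos j l' → c l j < c l' j) ∧ Bad (fun l => ord (c l)) := by
  classical
  by_contra hcon
  push Not at hcon
  have hkpos : 0 < k := by
    obtain ⟨j⟩ := ‹Nonempty J›
    have := h0 j lz; have := hk j lz; omega
  obtain ⟨R, hR⟩ : ∃ R, R = k * k + 3 * k := ⟨_, rfl⟩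
  have hkk : 0 < k * k := by positivity
  have hBR : B = R + k := by rw [hB, hR]; ring
  let Fit (l : Lab m) (z w : J → ℤ) : Prop := ∀ j, (-R ≤ w j ∧ w j ≤ R) ∧
    (pos j lz < pos j l → z j + k ≤ w j) ∧ (pos j l < pos j lz → w j + k ≤ z j)
  have E : ∀ (l : Lab m), l ≠ lz → l ≠ lz' → ∀ z w w' : J → ℤ, (∀ j, -R ≤ z j ∧ z j ≤ R) →
      Fit l z w → Fit l z w' → ord w < ord z → ord w' < ord z := by
    intro l hlz hlz' z w w' hz hw hw' hlt
    let C (w : J → ℤ) (l' : Lab m) (j : J) : ℤ :=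
      if l' = l then w j else
      if pos j lz < pos j l then
        (if pos j l' < pos j l then z j + (pos j l' - pos j lz) else R + pos j l')
      else (if pos j l < pos j l' then z j + (pos j l' - pos j lz) else - R - k + pos j l')
    have hpl : ∀ j l', l' ≠ l → pos j l' ≠ pos j l := fun j l' hne h => hne (hinj j h)
    have key : ∀ w, Fit l z w → ¬ Bad (fun l => ord (C w l)) := by
      intro w hw
      apply hcon
      · intro l' j
        have := h0 j l'; have := hk j l'; have := hw j; have := hz j
        have := h0 j lz; have := hk j lz
        simp only [C]
        split_ifs <;> omega
      · intro j l1 l2 hl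
        have := h0 j l1; have := hk j l1; have := h0 j l2; have := hk j l2
        have := h0 j lz; have := hk j lz
        have := hw j; have := hz j
        have := hpl j l1
        have := hpl j l2
        have := hpl j lz (Ne.symm hlz)
        by_cases a1 : l1 = l
        · by_cases a2 : l2 = l
          · rw [a1, a2] at hl; omega
          · rw [a1] at hl
            simp only [C, if_pos a1, if_neg a2]
            split_ifs <;> omega
        · by_cases a2 : l2 = l
          · rw [a2] at hl
            simp only [C, if_pos a2, if_neg a1]
            split_ifs <;> omega
          · simp only [C, if_neg a1, if_neg a2]
            split_ifs <;> omega
    have Cz : ∀ w, C w lz = z := by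
      intro w
      funext j
      have := hpl j lz (Ne.symm hlz)
      simp only [C, if_neg (Ne.symm hlz)]
      split_ifs <;> omega
    have Cl : ∀ w, C w l = w := by intro w; funext j; simp [C]
    have Co : ∀ w w' l', l' ≠ l → C w l' = C w' l' := by
      intro w w' l' h; funext j; simp [C, h]
    have k1 := key w hw
    have k2 := key w' hw'
    simp only [Bad, not_not, Cz] at k1 k2
    rcases l with i | i | b
    · have e : ∀ i', C w (ly i') = C w' (ly i') := fun i' => Co _ _ _ (by simp [ly])
      simp only [e] at k1
      have := exch_aux (fun i' => ord (C w (lx i')) < ord z) (fun i' => ord (C w' (lx i')) < ord z) i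
        (by intro i' hi'; simp only [Co w w' (lx i') (by simpa [lx] using hi')]) (k1.trans k2.symm)
        (by simpa only [lx, Cl] using hlt)
      simpa only [lx, Cl] using this
    · have e : ∀ i', C w (lx i') = C w' (lx i') := fun i' => Co _ _ _ (by simp [lx])
      simp only [e] at k1
      have := exch_aux (fun i' => ord (C w (ly i')) < ord z) (fun i' => ord (C w' (ly i')) < ord z) i
        (by intro i' hi'; simp only [Co w w' (ly i') (by simpa [ly] using hi')]) (k1.symm.trans k2)
        (by simpa only [ly, Cl] using hlt)
      simpa only [ly, Cl] using this
    · cases b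
      · exact absurd rfl hlz'
      · exact absurd rfl hlz
  let rg (a : J → ℤ) : Prop := ∀ j, -R ≤ a j ∧ a j ≤ R
  let ll (a b : J → ℤ) : Prop := ∀ j, a j + k ≤ b j
  have Ex : ∀ z u u', rg z → rg u → rg u' → ll u z → ll u' z → ord u < ord z → ord u' < ord z := by
    intro z u u' hz hu hu' h h'
    refine E (lx i0) (by simp) (by simp) z u u' hz ?_ ?_ <;> intro j
    · have := h1 j; have := h j; have := hu j; omega
    · have := h1 j; have := h' j; have := hu' j; omega
  have Ey : ∀ z u u', rg z → rg u → rg u' → ll z u → ll z u' → ord u < ord z → ord u' < ord z := by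
    intro z u u' hz hu hu' h h'
    refine E (ly i0) (by simp) (by simp) z u u' hz ?_ ?_ <;> intro j
    · have := h2 j; have := h j; have := hu j; omega
    · have := h2 j; have := h' j; have := hu' j; omega
  have ne : ∀ u v, rg u → rg v → ll u v → ord u ≠ ord v := by
    intro u v hu hv h he
    obtain ⟨j⟩ := ‹Nonempty J›
    have : u = v := hord (fun j => by have := hu j; omega) (fun j => by have := hv j; omega) he
    have h' := h j
    rw [this] at h'; omega
  have chain : ∀ a b c, rg a → rg b → rg c → ll a b → ll b c →
      (ord a < ord b ↔ ord b < ord c) ∧ (ord a < ord b ↔ ord a < ord c) := by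
    intro a b c ha hb hc hab hbc
    have hac : ll a c := fun j => by have := hab j; have := hbc j; omega
    have n1 := ne a b ha hb hab
    have n2 := ne b c hb hc hbc
    have n3 := ne a c ha hc hac
    have x1 := Ex c a b hc ha hb hac hbc
    have x2 := Ex c b a hc hb ha hbc hac
    have y1 := Ey a b c ha hb hc hab hac
    have y2 := Ey a c b ha hc hb hac hab
    omega
  have rbot : rg (fun _ => -3 * k) := fun j => by dsimp; constructor <;> linarith
  have rtop : rg (fun _ => 3 * k) := fun j => by dsimp; constructor <;> linarith
  have glob : ∀ p q, (∀ j, -2 * k ≤ p j ∧ p j ≤ 2 * k) → (∀ j, -2 * k ≤ q j ∧ q j ≤ 2 * k) →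
      ll p q → (ord p < ord q ↔ ord (fun _ : J => -3 * k) < ord (fun _ : J => 3 * k)) := by
    intro p q hp hq hpq
    have rp : rg p := fun j => by have := hp j; constructor <;> linarith
    have rq : rg q := fun j => by have := hq j; constructor <;> linarith
    have c1 := chain _ p q rbot rp rq (fun j => by have := hp j; linarith) hpq
    have c2 := chain _ p _ rbot rp rtop (fun j => by have := hp j; linarith)
      (fun j => by have := hp j; linarith)
    exact c1.1.symm.trans c2.2
  let z : J → ℤ := fun _ => 0
  let X (i : Fin m) (j : J) : ℤ := if pos j (lx i) < pos j lz then -2 * k else k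
  let Y (i : Fin m) (j : J) : ℤ := if pos j (ly i) < pos j lz then - k else 2 * k
  let c (l : Lab m) (j : J) : ℤ := k * (pos j l - pos j lz)
  have cz : c lz = z := by funext j; simp [c, z]
  have rz : rg z := fun j => by simp only [z]; constructor <;> linarith
  have rc : ∀ l, rg (c l) := by
    intro l j
    have := h0 j l; have := hk j l; have := h0 j lz; have := hk j lz
    simp only [c]; constructor <;> nlinarith
  have bX : ∀ i j, -2 * k ≤ X i j ∧ X i j ≤ 2 * k := by
    intro i j; simp only [X]; split_ifs <;> constructor <;> linarith
  have bY : ∀ i j, -2 * k ≤ Y i j ∧ Y i j ≤ 2 * k := by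
    intro i j; simp only [Y]; split_ifs <;> constructor <;> linarith
  have rX : ∀ i, rg (X i) := fun i j => by have := bX i j; constructor <;> linarith
  have rY : ∀ i, rg (Y i) := fun i j => by have := bY i j; constructor <;> linarith
  have fc : ∀ l, Fit l z (c l) := by
    intro l j
    refine ⟨rc l j, fun h => ?_, fun h => ?_⟩ <;> simp only [c, z] <;> nlinarith
  have fX : ∀ i, Fit (lx i) z (X i) := by
    intro i j
    refine ⟨rX i j, fun h => ?_, fun h => ?_⟩ <;> simp only [X, z] <;> split_ifs <;> linarith
  have fY : ∀ i, Fit (ly i) z (Y i) := by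
    intro i j
    refine ⟨rY i j, fun h => ?_, fun h => ?_⟩ <;> simp only [Y, z] <;> split_ifs <;> linarith
  have sX : ∀ i, ord (c (lx i)) < ord z ↔ ord (X i) < ord z := fun i =>
    ⟨E _ (by simp) (by simp) z _ _ rz (fc _) (fX i), E _ (by simp) (by simp) z _ _ rz (fX i) (fc _)⟩
  have sY : ∀ i, ord (c (ly i)) < ord z ↔ ord (Y i) < ord z := fun i =>
    ⟨E _ (by simp) (by simp) z _ _ rz (fc _) (fY i), E _ (by simp) (by simp) z _ _ rz (fY i) (fc _)⟩
  have XY : ∀ i, ll (X i) (Y i) := by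
    intro i j
    have := h3 j i
    simp only [X, Y]; split_ifs <;> first | linarith | (exfalso; tauto)
  have hfin := hcon c (fun l j => by have := rc l j; omega) (fun j l l' h => by
    simp only [c]; nlinarith)
  simp only [Bad, not_not, cz, sX, sY] at hfin
  have gX := glob (X i0) z (bX i0) (fun j => by simp only [z]; constructor <;> linarith)
    (fun j => by have := h1 j; simp only [X, z, if_pos this]; linarith)
  have gY := glob z (Y i0) (fun j => by simp only [z]; constructor <;> linarith) (bY i0)
    (fun j => by have := h2 j; simp only [Y, z, if_neg (not_lt.2 this.le)]; linarith)
  have gXY := fun i => glob (X i) (Y i) (bX i) (bY i) (XY i)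
  have nX : ord (X i0) ≠ ord z := ne _ _ (rX _) rz
    (fun j => by have := h1 j; simp only [X, z, if_pos this]; linarith)
  have nY : ord z ≠ ord (Y i0) := ne _ _ rz (rY _)
    (fun j => by have := h2 j; simp only [Y, z, if_neg (not_lt.2 this.le)]; linarith)
  have nXY := fun i => ne _ _ (rX i) (rY i) (XY i)
  by_cases hD : ord (fun _ : J => -3 * k) < ord (fun _ : J => 3 * k)
  · simp only [hD, iff_true] at gX gY gXY
    have : ord (Y i0) < ord z := exch_aux_sub _ _ (fun i h => (gXY i).trans h) hfin i0 gX
    omega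
  · simp only [hD, iff_false, not_lt] at gX gY gXY
    have : ord (X i0) < ord z := exch_aux_sub _ _ (fun i h => lt_of_le_of_lt (gXY i) h) hfin.symm i0
      (by omega)
    omega

open Classical in
lemma greedy {Ω T : Type} [Fintype Ω] [Fintype T] (conf : Ω → Ω → Prop)
    (hsymm : ∀ a b, conf a b → conf b a) (bad : T → Ω → Prop) (D P : ℝ) (m : ℕ)
    (hΩ : 0 < Fintype.card Ω) (hP : 0 ≤ P)
    (hD : ∀ a, ((Finset.univ.filter (fun b => conf a b)).card : ℝ) ≤ D)
    (hbad : ∀ t, P ≤ ((Finset.univ.filter (fun b => bad t b)).card : ℝ))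
    (hm : 2 * (m * D) ≤ P)
    (hT : (Fintype.card T : ℝ) * (1 - P / (2 * Fintype.card Ω)) ^ m < 1) :
    ∃ H : Finset Ω, (∀ a ∈ H, ∀ b ∈ H, a ≠ b → ¬ conf a b) ∧ ∀ t, ∃ a ∈ H, bad t a := by
  have hD0 : 0 ≤ D := by
    obtain ⟨a⟩ := Fintype.card_pos_iff.1 hΩ
    exact le_trans (by positivity) (hD a)
  have hΩ' : (0 : ℝ) < Fintype.card Ω := by exact_mod_cast hΩ
  have step : ∀ i : ℕ, i ≤ m → ∃ H : Finset Ω, H.card ≤ i ∧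
      (∀ a ∈ H, ∀ b ∈ H, a ≠ b → ¬ conf a b) ∧
      ((Finset.univ.filter (fun t => ∀ a ∈ H, ¬ bad t a)).card : ℝ) ≤
        Fintype.card T * (1 - P / (2 * Fintype.card Ω)) ^ i := by
    intro i
    induction i with
    | zero => intro _; exact ⟨∅, by simp, by simp, by simp⟩
    | succ i ih =>
      intro hi
      obtain ⟨H, hc, hp, hu⟩ := ih (by omega)
      set U := Finset.univ.filter (fun t => ∀ a ∈ H, ¬ bad t a) with hU
      set F := H.biUnion (fun a => Finset.univ.filter (fun b => conf a b)) with hF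
      have hFc : (F.card : ℝ) ≤ P / 2 := by
        have h1 : (F.card : ℝ) ≤ ∑ a ∈ H, ((Finset.univ.filter (fun b => conf a b)).card : ℝ) := by
          exact_mod_cast Finset.card_biUnion_le
        have h2 : ∑ a ∈ H, ((Finset.univ.filter (fun b => conf a b)).card : ℝ) ≤ H.card * D := by
          have := Finset.sum_le_card_nsmul H
            (fun a => ((Finset.univ.filter (fun b => conf a b)).card : ℝ)) D (fun a _ => hD a)
          simpa using this
        have h3 : (H.card : ℝ) * D ≤ m * D := by
          apply mul_le_mul_of_nonneg_right _ hD0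
          exact_mod_cast (by omega)
        linarith
      have hdc : ∑ ω ∈ Finset.univ \ F, ((U.filter (fun t => bad t ω)).card : ℝ)
          = ∑ t ∈ U, (((Finset.univ \ F).filter (fun ω => bad t ω)).card : ℝ) := by
        have := Finset.sum_card_bipartiteAbove_eq_sum_card_bipartiteBelow
          (s := Finset.univ \ F) (t := U) (fun ω t => bad t ω)
        unfold Finset.bipartiteAbove Finset.bipartiteBelow at this
        exact_mod_cast this
      have hge : ∀ t ∈ U, P / 2 ≤ (((Finset.univ \ F).filter (fun ω => bad t ω)).card : ℝ) := by
        intro t _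
        have h1 := hbad t
        have h2 : (Finset.univ.filter (fun b => bad t b)).card ≤
            ((Finset.univ \ F).filter (fun ω => bad t ω)).card + F.card := by
          refine le_trans (Finset.card_le_card ?_) (Finset.card_union_le _ _)
          intro a ha
          simp only [Finset.mem_filter, Finset.mem_univ, true_and, Finset.mem_union,
            Finset.mem_sdiff] at ha ⊢
          tauto
        have h2' : ((Finset.univ.filter (fun b => bad t b)).card : ℝ) ≤
            ((Finset.univ \ F).filter (fun ω => bad t ω)).card + F.card := by exact_mod_cast h2
        linarith
      have hsum : U.card * (P / 2) ≤
          ∑ ω ∈ Finset.univ \ F, ((U.filter (fun t => bad t ω)).card : ℝ) := by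
        rw [hdc]
        have := Finset.card_nsmul_le_sum U _ _ hge
        simpa using this
      have hex : U.Nonempty → 0 < P → ∃ ω ∈ Finset.univ \ F,
          U.card * (P / (2 * Fintype.card Ω)) ≤ ((U.filter (fun t => bad t ω)).card : ℝ) := by
        intro hne hP0
        by_contra hno
        push Not at hno
        have hne' : (Finset.univ \ F).Nonempty := by
          by_contra he
          rw [Finset.not_nonempty_iff_eq_empty] at he
          rw [he] at hsum
          have : (0:ℝ) < U.card := by exact_mod_cast hne.card_pos
          simp only [Finset.sum_empty] at hsum
          nlinarith
        have h1 := Finset.sum_lt_sum_of_nonempty hne' hno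
        have h2 : ∑ ω ∈ Finset.univ \ F, (U.card * (P / (2 * Fintype.card Ω)) : ℝ) ≤
            U.card * (P / 2) := by
          rw [Finset.sum_const, nsmul_eq_mul]
          have h3 : ((Finset.univ \ F).card : ℝ) ≤ Fintype.card Ω := by
            exact_mod_cast Finset.card_le_univ _
          calc _ ≤ (Fintype.card Ω : ℝ) * (U.card * (P / (2 * Fintype.card Ω))) := by
                apply mul_le_mul_of_nonneg_right h3; positivity
            _ = _ := by field_simp
        linarith
      by_cases hcase : U.Nonempty ∧ 0 < P
      · obtain ⟨ω, hω, hlarge⟩ := hex hcase.1 hcase.2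
        refine ⟨insert ω H, (Finset.card_insert_le _ _).trans (by omega), ?_, ?_⟩
        · have hn : ∀ a ∈ H, ¬ conf a ω := by
            intro a ha hca
            simp only [hF, Finset.mem_sdiff, Finset.mem_univ, true_and, Finset.mem_biUnion,
              Finset.mem_filter, not_exists, not_and] at hω
            exact hω a ha hca
          intro a ha b hb hab
          rw [Finset.mem_insert] at ha hb
          rcases ha with rfl | ha <;> rcases hb with rfl | hb
          · exact absurd rfl hab
          · exact fun h => hn b hb (hsymm _ _ h)
          · exact hn a ha
          · exact hp a ha b hb hab
        · have hsplit : (Finset.univ.filter (fun t => ∀ a ∈ insert ω H, ¬ bad t a)) =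
              U.filter (fun t => ¬ bad t ω) := by
            ext t; simp [hU]; tauto
          have hcs := Finset.card_filter_add_card_filter_not (s := U) (fun t => bad t ω)
          have hcs' : ((U.filter (fun t => bad t ω)).card : ℝ) +
            (U.filter (fun t => ¬ bad t ω)).card = U.card := by exact_mod_cast hcs
          rw [hsplit]
          have hq : 0 ≤ 1 - P / (2 * Fintype.card Ω : ℝ) := by
            have hPle : P ≤ Fintype.card Ω := by
              obtain ⟨t, ht⟩ := hcase.1
              exact (hbad t).trans (by exact_mod_cast Finset.card_le_univ _)
            rw [sub_nonneg, div_le_one (by positivity)]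
            linarith
          calc ((U.filter (fun t => ¬ bad t ω)).card : ℝ)
              ≤ U.card * (1 - P / (2 * Fintype.card Ω)) := by linarith
            _ ≤ (Fintype.card T * (1 - P / (2 * Fintype.card Ω)) ^ i) *
                (1 - P / (2 * Fintype.card Ω)) := mul_le_mul_of_nonneg_right hu hq
            _ = _ := by ring
      · refine ⟨H, by omega, hp, ?_⟩
        rw [not_and_or] at hcase
        rcases hcase with h | h
        · rw [Finset.not_nonempty_iff_eq_empty] at h
          rw [← hU, h]
          by_cases hTe : Nonempty T
          · obtain ⟨t⟩ := hTe
            have hPle : P ≤ Fintype.card Ω :=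
              (hbad t).trans (by exact_mod_cast Finset.card_le_univ _)
            have hq : 0 ≤ 1 - P / (2 * Fintype.card Ω : ℝ) := by
              rw [sub_nonneg, div_le_one (by positivity)]
              linarith
            simp only [Finset.card_empty, Nat.cast_zero]
            positivity
          · have : Fintype.card T = 0 := Fintype.card_eq_zero_iff.2 (not_nonempty_iff.1 hTe)
            simp [this]
        · have : P = 0 := by linarith
          simpa [this] using hu
  obtain ⟨H, -, hp, hu⟩ := step m le_rfl
  refine ⟨H, hp, fun t => ?_⟩
  by_contra hno
  push Not at hno
  have : 0 < (Finset.univ.filter (fun t => ∀ a ∈ H, ¬ bad t a)).card :=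
    Finset.card_pos.2 ⟨t, by simpa using hno⟩
  have h1 : (1 : ℝ) ≤ (Finset.univ.filter (fun t => ∀ a ∈ H, ¬ bad t a)).card := by
    exact_mod_cast this
  linarith

lemma fiber_card {S T : Type} [Fintype S] [Fintype T] (n : ℕ)
    (g : T → S) (hg : Function.Injective g) (u : T → Fin n) [DecidableEq S] [DecidableEq T] :
    (Finset.univ.filter (fun s : S → Fin n => ∀ i, s (g i) = u i)).card * n ^ Fintype.card T
      ≤ n ^ Fintype.card S := by
  classical
  have h : Fintype.card ({s : S → Fin n // ∀ i, s (g i) = u i} × (T → Fin n)) ≤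
      Fintype.card (S → Fin n) := by
    apply Fintype.card_le_of_injective (fun p => Function.extend g p.2 p.1.1)
    rintro ⟨⟨s, hs⟩, v⟩ ⟨⟨s', hs'⟩, v'⟩ he
    dsimp only at he
    have hv : v = v' := by
      funext i
      have := congrFun he (g i)
      rwa [hg.extend_apply, hg.extend_apply] at this
    have hss : s = s' := by
      funext a
      by_cases ha : ∃ i, g i = a
      · obtain ⟨i, rfl⟩ := ha
        rw [hs, hs']
      · have := congrFun he a
        rwa [Function.extend_apply' _ _ _ ha, Function.extend_apply' _ _ _ ha] at this
    subst hv hss; rfl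
  simpa [Fintype.card_prod, Fintype.card_subtype] using h



lemma exists_param (a b : ℕ) (c : ℝ) (hc0 : 0 ≤ c) (hc1 : c < 1) :
    ∃ p : ℕ, 1 ≤ p ∧ ((a * b * p : ℕ) : ℝ) ^ a * c ^ p < 1 := by
  have h := tendsto_pow_const_mul_const_pow_of_abs_lt_one a (r := c) (by rwa [abs_of_nonneg hc0])
  have h2 := h.const_mul (((a * b : ℕ) : ℝ) ^ a)
  rw [mul_zero] at h2
  obtain ⟨p, hp1, hp⟩ := ((h2.eventually_lt_const one_pos).and
    (Filter.eventually_ge_atTop 1)).exists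
  refine ⟨p, hp, ?_⟩
  push_cast at hp1 ⊢
  calc _ = _ := by ring
    _ < 1 := hp1

open Classical in
lemma sparse {A K : Type} [Fintype A] [Fintype K] [Nonempty K] (Cp : (K → A) → Prop)
    (hCp : ∀ c, Cp c → Function.Injective c) (bad : (K → ℕ) → Prop)
    (hbase : ∀ ord : A → ℕ, Function.Injective ord → ∃ c, Cp c ∧ bad (fun l => ord (c l))) :
    ∃ n : ℕ, ∃ H : Finset ({c // Cp c} × (K → Fin n)),
      (∀ ω ∈ H, ∀ ω' ∈ H, ω ≠ ω' → ∀ l1 l2 l1' l2', l1 ≠ l2 →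
        (ω.1.1 l1, ω.2 l1) = (ω'.1.1 l1', ω'.2 l1') →
        (ω.1.1 l2, ω.2 l2) = (ω'.1.1 l2', ω'.2 l2') → False) ∧
      ∀ t : A × Fin n → ℕ, Function.Injective t → (∀ v, t v < Fintype.card A * n) →
        ∃ ω ∈ H, bad (fun l => t (ω.1.1 l, ω.2 l)) := by
  obtain ⟨c0, hc0, -⟩ := hbase (fun a => (Fintype.equivFin A a : ℕ))
    (fun a b h => (Fintype.equivFin A).injective (Fin.ext h))
  set N := Fintype.card {c // Cp c} with hN
  have hN1 : 1 ≤ N := Fintype.card_pos_iff.2 ⟨⟨c0, hc0⟩⟩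
  set k := Fintype.card K with hk
  have hk1 : 1 ≤ k := Fintype.card_pos
  set a := Fintype.card A with ha
  have ha1 : 1 ≤ a := by
    obtain ⟨l⟩ := ‹Nonempty K›
    exact Fintype.card_pos_iff.2 ⟨c0 l⟩
  obtain ⟨β, hβ⟩ : ∃ β, β = 2 * N * k ^ 4 := ⟨_, rfl⟩
  have hβ1 : 1 ≤ β := by rw [hβ]; exact Nat.one_le_iff_ne_zero.2 (by positivity)
  have hNR : (1 : ℝ) ≤ N := by exact_mod_cast hN1
  have hq : (1 : ℝ) / (2 * N) ≤ 1 := by rw [div_le_one (by positivity)]; linarith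
  have hq0 : (0 : ℝ) < 1 / (2 * N) := by positivity
  obtain ⟨p, hp1, hp⟩ := exists_param a β (1 - 1 / (2 * N)) (by linarith) (by linarith)
  obtain ⟨n, hn⟩ : ∃ n, n = β * p := ⟨_, rfl⟩
  have hn1 : 0 < n := by rw [hn]; positivity
  have hnR : (0 : ℝ) < n := by exact_mod_cast hn1
  have hΩc : Fintype.card ({c // Cp c} × (K → Fin n)) = N * n ^ k := by
    simp [Fintype.card_prod, hN, hk]
  let conf (ω ω' : {c // Cp c} × (K → Fin n)) : Prop :=
    ∃ l1 l2 l1' l2', l1 ≠ l2 ∧ (ω.1.1 l1, ω.2 l1) = (ω'.1.1 l1', ω'.2 l1') ∧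
        (ω.1.1 l2, ω.2 l2) = (ω'.1.1 l2', ω'.2 l2')
  have conf_ne : ∀ (ω ω' : {c // Cp c} × (K → Fin n)) l1 l2 l1' l2', l1 ≠ l2 →
      (ω.1.1 l1, ω.2 l1) = (ω'.1.1 l1', ω'.2 l1') →
      (ω.1.1 l2, ω.2 l2) = (ω'.1.1 l2', ω'.2 l2') → l1' ≠ l2' := by
    intro ω ω' l1 l2 l1' l2' hne h1 h2 he
    subst he
    exact hne (hCp _ ω.1.2 (congrArg Prod.fst (h1.trans h2.symm)))
  refine Exists.elim (greedy (Ω := {c // Cp c} × (K → Fin n))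
    (T := {t : A × Fin n → Fin (a * n) // Function.Injective t}) conf ?_
    (fun t ω => bad (fun l => (t.1 (ω.1.1 l, ω.2 l) : ℕ)))
    (N * k ^ 4 * n ^ k / n ^ 2) (n ^ k) (β * p ^ 2) ?_ (by positivity) ?_ ?_ ?_ ?_) ?_
  · rintro ω ω' ⟨l1, l2, l1', l2', hl, e1, e2⟩
    exact ⟨l1', l2', l1, l2, conf_ne _ _ _ _ _ _ hl e1 e2, e1.symm, e2.symm⟩
  · rw [hΩc]; positivity
  · intro ω
    have hcard : (Finset.univ.filter (fun ω' => conf ω ω')).card * n ^ 2 ≤ N * k ^ 4 * n ^ k := by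
      let S (q : (K × K) × (K × K)) : Finset ({c // Cp c} × (K → Fin n)) :=
        if q.2.1 ≠ q.2.2 then
        (Finset.univ : Finset {c // Cp c}) ×ˢ (Finset.univ.filter (fun s : K → Fin n =>
          ∀ i : Bool, s ((fun i : Bool => if i then q.2.1 else q.2.2) i) =
            (fun i : Bool => if i then ω.2 q.1.1 else ω.2 q.1.2) i)) else ∅
      have hsub : Finset.univ.filter (fun ω' => conf ω ω') ⊆
          (Finset.univ : Finset ((K × K) × (K × K))).biUnion S := by
        intro ω' hω'
        simp only [Finset.mem_filter, Finset.mem_univ, true_and] at hω'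
        obtain ⟨l1, l2, l1', l2', hl, e1, e2⟩ := hω'
        have := conf_ne _ _ _ _ _ _ hl e1 e2
        rw [Finset.mem_biUnion]
        refine ⟨((l1, l2), (l1', l2')), Finset.mem_univ _, ?_⟩
        simp only [S, if_pos this, Finset.mem_product, Finset.mem_univ, true_and,
          Finset.mem_filter]
        intro i
        cases i
        · simpa using (congrArg Prod.snd e2).symm
        · simpa using (congrArg Prod.snd e1).symm
      have hS : ∀ q, (S q).card * n ^ 2 ≤ N * n ^ k := by
        intro q
        simp only [S]
        split_ifs with hne
        · rw [Finset.card_product, Finset.card_univ, mul_assoc]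
          apply Nat.mul_le_mul_left
          have := fiber_card (S := K) (T := Bool) n (fun i : Bool => if i then q.2.1 else q.2.2)
            (by
              intro i j h
              cases i <;> cases j <;> simp at h ⊢
              · exact hne h.symm
              · exact hne h) (fun i : Bool => if i then ω.2 q.1.1 else ω.2 q.1.2)
          simpa using this
        · simp
      calc _ ≤ (∑ q, (S q).card) * n ^ 2 :=
            Nat.mul_le_mul_right _ ((Finset.card_le_card hsub).trans Finset.card_biUnion_le)
        _ = ∑ q, (S q).card * n ^ 2 := Finset.sum_mul _ _ _
        _ ≤ ∑ q : (K × K) × (K × K), N * n ^ k := Finset.sum_le_sum (fun q _ => hS q)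
        _ = N * k ^ 4 * n ^ k := by
            simp [Fintype.card_prod, ← hk]; ring
    rw [le_div_iff₀ (by positivity)]
    have hcard' : ((Finset.univ.filter (fun ω' => conf ω ω')).card : ℝ) * n ^ 2 ≤
      N * k ^ 4 * n ^ k := by exact_mod_cast hcard
    refine le_trans (le_of_eq ?_) hcard'
    congr!
  · rintro ⟨t, ht⟩
    dsimp only
    set G := Finset.univ.filter (fun ω : {c // Cp c} × (K → Fin n) =>
      bad (fun l => (t (ω.1.1 l, ω.2 l) : ℕ))) with hG
    have hex : ∀ s : A → Fin n, ∃ ω ∈ G, ∀ l, s (ω.1.1 l) = ω.2 l := by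
      intro s
      obtain ⟨c, hc, hb⟩ := hbase (fun x => (t (x, s x) : ℕ)) (fun x y h => by
        have := ht (Fin.ext h)
        exact congrArg Prod.fst this)
      exact ⟨(⟨c, hc⟩, fun l => s (c l)), by simpa [hG] using hb, fun l => rfl⟩
    have hsub : (Finset.univ : Finset (A → Fin n)) ⊆ G.biUnion (fun ω =>
        Finset.univ.filter (fun s : A → Fin n => ∀ l, s (ω.1.1 l) = ω.2 l)) := by
      intro s _
      obtain ⟨ω, h1, h2⟩ := hex s
      rw [Finset.mem_biUnion]
      exact ⟨ω, h1, by simpa using h2⟩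
    have h1 : n ^ a ≤ ∑ ω ∈ G,
        (Finset.univ.filter (fun s : A → Fin n => ∀ l, s (ω.1.1 l) = ω.2 l)).card := by
      have := (Finset.card_le_card hsub).trans Finset.card_biUnion_le
      simpa [Finset.card_univ, ← ha] using this
    have h2 : n ^ a * n ^ k ≤ G.card * n ^ a := by
      calc _ ≤ _ := Nat.mul_le_mul_right (n ^ k) h1
        _ = ∑ ω ∈ G, (Finset.univ.filter (fun s : A → Fin n =>
            ∀ l, s (ω.1.1 l) = ω.2 l)).card * n ^ k := Finset.sum_mul _ _ _
        _ ≤ ∑ ω ∈ G, n ^ a := Finset.sum_le_sum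
            (fun ω _ => fiber_card (S := A) (T := K) n ω.1.1 (hCp _ ω.1.2) ω.2)
        _ = _ := by simp
    have h3 : n ^ k ≤ G.card := by
      have : 0 < n ^ a := by positivity
      nlinarith
    exact_mod_cast h3
  · have hβR : (β : ℝ) = 2 * N * k ^ 4 := by rw [hβ]; push_cast; ring
    have hpR : (0 : ℝ) < p := by exact_mod_cast hp1
    have hbR : (0 : ℝ) < β := by exact_mod_cast hβ1
    have hn' : (n : ℝ) = β * p := by rw [hn]; push_cast; ring
    apply le_of_eq
    calc 2 * (((β * p ^ 2 : ℕ) : ℝ) * (N * k ^ 4 * n ^ k / n ^ 2))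
        = (2 * N * k ^ 4) * (β * p ^ 2) * n ^ k / n ^ 2 := by push_cast; ring
      _ = (n : ℝ) ^ 2 * n ^ k / n ^ 2 := by rw [← hβR, hn']; ring
      _ = _ := by field_simp
  · rw [hΩc]
    have e : (n : ℝ) ^ k / (2 * ((N * n ^ k : ℕ) : ℝ)) = 1 / (2 * N) := by
      push_cast; field_simp
    rw [e]
    have hTc : Fintype.card {t : A × Fin n → Fin (a * n) // Function.Injective t} ≤
        (a * n) ^ (a * n) := by
      refine (Fintype.card_subtype_le _).trans ?_
      simp [← ha]
    have hcc : 0 ≤ 1 - 1 / (2 * (N : ℝ)) := by linarith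
    calc _ ≤ (((a * n) ^ (a * n) : ℕ) : ℝ) * (1 - 1 / (2 * N)) ^ (β * p ^ 2) := by
          apply mul_le_mul_of_nonneg_right (by exact_mod_cast hTc) (by positivity)
      _ = (((a * β * p : ℕ) : ℝ) ^ a * (1 - 1 / (2 * N)) ^ p) ^ (β * p) := by
          rw [hn, mul_pow (_ ^ a) (_ ^ p), ← pow_mul, ← pow_mul]
          push_cast
          congr 1
          · congr 1 <;> ring
          · congr 1; ring
      _ < 1 := pow_lt_one₀ (by positivity) hp (by positivity)
  · rintro H ⟨hH1, hH2⟩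
    refine ⟨n, H, ?_, ?_⟩
    · intro ω hω ω' hω' hne l1 l2 l1' l2' hl e1 e2
      exact hH1 ω hω ω' hω' hne ⟨l1, l2, l1', l2', hl, e1, e2⟩
    · intro t ht hlt
      exact hH2 ⟨fun v => ⟨t v, hlt v⟩, fun u v h => ht (by simpa using h)⟩


def GoodPos {m k : ℕ} (i0 : Fin m) (pos : Lab m → Fin k) : Prop :=
  Function.Injective pos ∧ pos (lx i0) < pos lz ∧ pos lz < pos (ly i0) ∧
    ∀ i, pos (ly i) < pos lz → pos (lx i) < pos lz

lemma enum_lt {k m : ℕ} (s : Finset (Fin k)) (h : s.card = m) (z : Fin k) (i : Fin m) :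
    s.orderEmbOfFin h i < z ↔ (i : ℕ) < (s.filter (fun j => j < z)).card := by
  have himg : s.filter (fun j => j < z) =
      (Finset.univ.filter (fun i => s.orderEmbOfFin h i < z)).map
        (s.orderEmbOfFin h).toEmbedding := by
    ext j
    simp only [Finset.mem_filter, Finset.mem_map, Finset.mem_univ, true_and]
    constructor
    · rintro ⟨h1, h2⟩
      have : j ∈ Set.range (s.orderEmbOfFin h) := by
        rw [Finset.range_orderEmbOfFin]; exact h1
      obtain ⟨i, rfl⟩ := this
      exact ⟨i, h2, rfl⟩
    · rintro ⟨i, h1, rfl⟩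
      exact ⟨Finset.orderEmbOfFin_mem s h i, h1⟩
  rw [himg, Finset.card_map]
  constructor
  · intro hi
    have : Finset.Iic i ⊆ Finset.univ.filter (fun i => s.orderEmbOfFin h i < z) := by
      intro j hj
      simp only [Finset.mem_Iic] at hj
      simp only [Finset.mem_filter, Finset.mem_univ, true_and]
      exact lt_of_le_of_lt ((s.orderEmbOfFin h).monotone hj) hi
    have := Finset.card_le_card this
    rw [Fin.card_Iic] at this
    omega
  · intro hi
    by_contra hn
    have : Finset.univ.filter (fun i => s.orderEmbOfFin h i < z) ⊆ Finset.Iio i := by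
      intro j hj
      simp only [Finset.mem_filter, Finset.mem_univ, true_and] at hj
      rw [Finset.mem_Iio]
      by_contra hji
      exact hn (lt_of_le_of_lt ((s.orderEmbOfFin h).monotone (not_lt.1 hji)) hj)
    have := Finset.card_le_card this
    rw [Fin.card_Iio] at this
    omega

lemma pos_of_seq {m k : ℕ} (i0 : Fin m) (hi0 : (i0 : ℕ) = 0) (σ : Fin k → Letter) (a b : Letter)
    (hab : a ≠ b) (haz : a ≠ Letter.Z) (hbz : b ≠ Letter.Z)
    (ha : (Finset.univ.filter (fun i => σ i = a)).card = m)
    (hb : (Finset.univ.filter (fun i => σ i = b)).card = m)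
    (hz : (Finset.univ.filter (fun i => σ i = Letter.Z)).card = 2)
    (z : Fin k) (hσz : σ z = Letter.Z)
    (hlt : ((Finset.univ.filter (fun i => σ i = b)).filter (fun j => j < z)).card <
      ((Finset.univ.filter (fun i => σ i = a)).filter (fun j => j < z)).card) :
    ∃ pos : Lab m → Fin k, GoodPos i0 pos ∧ (∀ i, σ (pos (lx i)) = a) ∧
      (∀ i, σ (pos (ly i)) = b) ∧ ∀ c, σ (pos (Sum.inr (Sum.inr c))) = Letter.Z := by
  obtain ⟨z', hz', hne⟩ : ∃ z', σ z' = Letter.Z ∧ z' ≠ z := by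
    have : 1 < (Finset.univ.filter (fun i => σ i = Letter.Z)).card := by omega
    obtain ⟨z', h1, h2⟩ := Finset.exists_mem_ne this z
    exact ⟨z', by simpa using h1, h2⟩
  set sa := Finset.univ.filter (fun i => σ i = a) with hsa
  set sb := Finset.univ.filter (fun i => σ i = b) with hsb
  let rot (i : Fin m) : Fin m := ⟨if (i : ℕ) = 0 then m - 1 else i - 1, by
    have := i.2; split_ifs <;> omega⟩
  have hrot : Function.Injective rot := by
    intro i j h
    have h' := congrArg Fin.val h
    have := i.2; have := j.2
    simp only [rot] at h'
    apply Fin.ext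
    split_ifs at h' <;> omega
  have ma : ∀ i, σ (sa.orderEmbOfFin ha i) = a := fun i => by
    have := Finset.orderEmbOfFin_mem sa ha i
    exact (Finset.mem_filter.1 this).2
  have mb : ∀ i, σ (sb.orderEmbOfFin hb i) = b := fun i => by
    have := Finset.orderEmbOfFin_mem sb hb i
    exact (Finset.mem_filter.1 this).2
  have hble : (sb.filter (fun j => j < z)).card < m :=
    lt_of_lt_of_le hlt ((Finset.card_filter_le _ _).trans ha.le)
  refine ⟨fun l => match l with
    | Sum.inl i => sa.orderEmbOfFin ha i
    | Sum.inr (Sum.inl i) => sb.orderEmbOfFin hb (rot i)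
    | Sum.inr (Sum.inr true) => z
    | Sum.inr (Sum.inr false) => z', ⟨?_, ?_, ?_, ?_⟩, ma, fun i => mb _, ?_⟩
  · rintro (i | i | i) (j | j | j) h
    · simpa using h
    · have h := congrArg σ h
      simp only [ma, mb] at h
      exact absurd h hab
    · have h := congrArg σ h
      cases j <;> simp only [ma, hz', hσz] at h <;> exact absurd h haz
    · have h := congrArg σ h
      simp only [ma, mb] at h
      exact absurd h.symm hab
    · have := hrot ((sb.orderEmbOfFin hb).injective h)
      rw [this]
    · have h := congrArg σ h
      cases j <;> simp only [mb, hz', hσz] at h <;> exact absurd h hbz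
    · have h := congrArg σ h
      cases i <;> simp only [ma, hz', hσz] at h <;> exact absurd h.symm haz
    · have h := congrArg σ h
      cases i <;> simp only [mb, hz', hσz] at h <;> exact absurd h.symm hbz
    · cases i <;> cases j
      · rfl
      · exact absurd h hne
      · exact absurd h.symm hne
      · rfl
  · show sa.orderEmbOfFin ha i0 < z
    rw [enum_lt]; omega
  · show z < sb.orderEmbOfFin hb (rot i0)
    have h1 : ¬ sb.orderEmbOfFin hb (rot i0) < z := by
      rw [enum_lt]; simp only [rot, hi0, if_true]; omega
    refine lt_of_le_of_ne (not_lt.1 h1) (fun h => ?_)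
    have := mb (rot i0)
    rw [← h, hσz] at this
    exact hbz this.symm
  · intro i
    show sb.orderEmbOfFin hb (rot i) < z → sa.orderEmbOfFin ha i < z
    rw [enum_lt, enum_lt]
    simp only [rot]
    split_ifs <;> omega
  · intro c; cases c
    · exact hz'
    · exact hσz

lemma pos_of_inconsistent {r m : ℕ} (hm : r - 2 = m) (i0 : Fin m) (hi0 : (i0 : ℕ) = 0)
    (σ : Fin (2 * r - 2) → Letter) (hσ : SeqInconsistent r σ) :
    ∃ pos : Lab m → Fin (2 * r - 2), GoodPos i0 pos ∧
      (∀ c, σ (pos (Sum.inr (Sum.inr c))) = Letter.Z) ∧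
      (((∀ i, σ (pos (lx i)) = Letter.X) ∧ (∀ i, σ (pos (ly i)) = Letter.Y)) ∨
       ((∀ i, σ (pos (lx i)) = Letter.Y) ∧ (∀ i, σ (pos (ly i)) = Letter.X))) := by
  obtain ⟨⟨hX, hY, hZ⟩, hinc⟩ := hσ
  rw [hm] at hX hY
  obtain ⟨z, hz, hne⟩ : ∃ z, σ z = Letter.Z ∧
      ((Finset.univ.filter (fun i => σ i = Letter.X)).filter (fun j => j < z)).card ≠
      ((Finset.univ.filter (fun i => σ i = Letter.Y)).filter (fun j => j < z)).card := by
    by_contra hno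
    push Not at hno
    apply hinc
    unfold SeqConsistent seqRole
    apply Finset.image_congr
    intro z hz
    have hz' : σ z = Letter.Z := by simpa using hz
    have h := hno z hz'
    have e1 : Finset.univ.filter (fun j => σ j ≠ Letter.Y ∧ j < z) =
      (Finset.univ.filter (fun i => σ i = Letter.X)).filter (fun j => j < z) ∪
      (Finset.univ.filter (fun i => σ i = Letter.Z)).filter (fun j => j < z) := by
      ext j
      simp only [Finset.mem_filter, Finset.mem_univ, true_and, Finset.mem_union]
      cases σ j <;> simp
    have e2 : Finset.univ.filter (fun j => σ j ≠ Letter.X ∧ j < z) =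
      (Finset.univ.filter (fun i => σ i = Letter.Y)).filter (fun j => j < z) ∪
      (Finset.univ.filter (fun i => σ i = Letter.Z)).filter (fun j => j < z) := by
      ext j
      simp only [Finset.mem_filter, Finset.mem_univ, true_and, Finset.mem_union]
      cases σ j <;> simp
    dsimp only
    rw [e1, e2, Finset.card_union_of_disjoint, Finset.card_union_of_disjoint, h]
    all_goals
      rw [Finset.disjoint_left]
      intro j h1 h2
      simp only [Finset.mem_filter, Finset.mem_univ, true_and] at h1 h2
      rw [h1.1] at h2
      simp at h2
  rcases lt_or_gt_of_ne hne with h | h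
  · obtain ⟨pos, h1, h2, h3, h4⟩ := pos_of_seq i0 hi0 σ Letter.Y Letter.X (by simp) (by simp)
      (by simp) hY hX hZ z hz h
    exact ⟨pos, h1, h4, Or.inr ⟨h2, h3⟩⟩
  · obtain ⟨pos, h1, h2, h3, h4⟩ := pos_of_seq i0 hi0 σ Letter.X Letter.Y (by simp) (by simp)
      (by simp) hX hY hZ z hz h
    exact ⟨pos, h1, h4, Or.inl ⟨h2, h3⟩⟩

lemma exists_goodPos {r m : ℕ} (hr : 3 ≤ r) (hm : r - 2 = m) (i0 : Fin m) :
    ∃ pos : Lab m → Fin (2 * r - 2), GoodPos i0 pos := by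
  refine ⟨fun l => match l with
    | Sum.inl i => ⟨i, by have := i.2; omega⟩
    | Sum.inr (Sum.inl i) => ⟨m + 2 + i, by have := i.2; omega⟩
    | Sum.inr (Sum.inr true) => ⟨m, by omega⟩
    | Sum.inr (Sum.inr false) => ⟨m + 1, by omega⟩, ?_, ?_, ?_, ?_⟩
  · rintro (i | i | i) (j | j | j) h
    all_goals try cases i
    all_goals try cases j
    all_goals simp only [Fin.mk.injEq] at h
    all_goals first | rfl | (simp only [Sum.inl.injEq, Sum.inr.injEq, Fin.mk.injEq]; omega) |
      (exfalso; omega)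
  · rw [Fin.lt_def]; exact i0.2
  · rw [Fin.lt_def]; dsimp only; omega
  · intro i h
    rw [Fin.lt_def] at h; dsimp only at h; omega


/-- labels of the two edges of a twin pair -/
def phi {m : ℕ} (b : Bool) : Fin m ⊕ Bool → Lab m
  | Sum.inl i => if b then lx i else ly i
  | Sum.inr c => Sum.inr (Sum.inr c)

lemma phi_inj {m : ℕ} (b : Bool) : Function.Injective (phi (m := m) b) := by
  rintro (i | i) (j | j) h <;> cases b <;> simp_all [phi]

lemma mem_phi {m : ℕ} (b : Bool) (l : Lab m) :
    (∃ u, phi b u = l) ↔ ∀ i, l ≠ if b then ly i else lx i := by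
  constructor
  · rintro ⟨i | i, rfl⟩ j <;> cases b <;> simp [phi]
  · intro h
    rcases l with i | i | c
    · cases b
      · exact absurd rfl (h i)
      · exact ⟨Sum.inl i, by simp [phi]⟩
    · cases b
      · exact ⟨Sum.inl i, by simp [phi]⟩
      · exact absurd rfl (h i)
    · exact ⟨Sum.inr c, by simp [phi]⟩

/-- edge number `b` of a configuration -/
def edg {m : ℕ} (v : Lab m → ℕ) (b : Bool) : Finset ℕ :=
  Finset.univ.image (fun u => v (phi b u))

lemma mem_edg {m : ℕ} (v : Lab m → ℕ) (hv : Function.Injective v) (b : Bool) (l : Lab m) :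
    v l ∈ edg v b ↔ ∀ i, l ≠ if b then ly i else lx i := by
  rw [← mem_phi]
  simp only [edg, Finset.mem_image, Finset.mem_univ, true_and]
  constructor
  · rintro ⟨u, h⟩; exact ⟨u, hv h⟩
  · rintro ⟨u, h⟩; exact ⟨u, by rw [h]⟩

lemma edg_sub {m : ℕ} (v : Lab m → ℕ) (b : Bool) (x : ℕ) (hx : x ∈ edg v b) : ∃ l, v l = x := by
  simp only [edg, Finset.mem_image, Finset.mem_univ, true_and] at hx
  obtain ⟨u, h⟩ := hx
  exact ⟨_, h⟩

lemma edg_card {m : ℕ} (v : Lab m → ℕ) (hv : Function.Injective v) (b : Bool) :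
    (edg v b).card = m + 2 := by
  rw [edg, Finset.card_image_of_injective _ (show Function.Injective (fun u => v (phi b u)) from hv.comp (phi_inj b))]
  simp

lemma edg_inter {m : ℕ} (v : Lab m → ℕ) (hv : Function.Injective v) (b : Bool) :
    edg v b ∩ edg v (!b) = {v lz, v lz'} := by
  ext x
  simp only [Finset.mem_inter, Finset.mem_insert, Finset.mem_singleton]
  constructor
  · rintro ⟨h1, h2⟩
    obtain ⟨l, rfl⟩ := edg_sub v b x h1
    rw [mem_edg v hv] at h1 h2
    rcases l with i | i | c
    · cases b
      · exact absurd rfl (h1 i)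
      · exact absurd rfl (h2 i)
    · cases b
      · exact absurd rfl (h2 i)
      · exact absurd rfl (h1 i)
    · cases c <;> simp
  · rintro (rfl | rfl) <;> rw [mem_edg v hv, mem_edg v hv] <;> cases b <;> simp

lemma edg_inter_card {m : ℕ} (v : Lab m → ℕ) (hv : Function.Injective v) (b : Bool) :
    (edg v b ∩ edg v (!b)).card = 2 := by
  rw [edg_inter v hv, Finset.card_pair]
  intro h; simpa using hv h

lemma rank_edg {m : ℕ} (v : Lab m → ℕ) (hv : Function.Injective v) (b : Bool) (ord : ℕ → ℕ) :
    ((edg v b).filter (fun w => ord w < ord (v lz))).card =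
      (Finset.univ.filter (fun i => ord (v (if b then lx i else ly i)) < ord (v lz))).card +
        if ord (v lz') < ord (v lz) then 1 else 0 := by
  rw [edg, Finset.filter_image, Finset.card_image_of_injective _ (show Function.Injective (fun u => v (phi b u)) from hv.comp (phi_inj b)),
    Finset.card_filter, Fintype.sum_sum_type, Fintype.sum_bool, Finset.card_filter]
  simp [phi]
  rw [Finset.card_filter]
  first
    | rfl
    | (congr 1; apply Finset.sum_congr rfl; intro i _; congr)

lemma rank_lt (ord : ℕ → ℕ) (e : Finset ℕ) (p q : ℕ) (hp : p ∈ e) (h : ord p < ord q) :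
    (e.filter (fun w => ord w < ord p)).card < (e.filter (fun w => ord w < ord q)).card := by
  apply Finset.card_lt_card
  rw [Finset.ssubset_iff_of_subset]
  · exact ⟨p, by simp [hp, h], by simp⟩
  · intro w hw
    simp only [Finset.mem_filter] at hw ⊢
    exact ⟨hw.1, hw.2.trans h⟩

lemma not_bad_of_role {m : ℕ} (v : Lab m → ℕ) (hv : Function.Injective v) (ord : ℕ → ℕ)
    (hne : ord (v lz) ≠ ord (v lz'))
    (h : role ord (edg v true) (edg v true ∩ edg v false) =
      role ord (edg v false) (edg v true ∩ edg v false)) : ¬ Bad (fun l => ord (v l)) := by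
  have hi := edg_inter v hv true
  rw [Bool.not_true] at hi
  rw [hi] at h
  have mz : ∀ b c, v (Sum.inr (Sum.inr c)) ∈ edg v b := by
    intro b c; rw [mem_edg v hv]; cases b <;> simp
  have r1 := rank_edg v hv true ord
  have r2 := rank_edg v hv false ord
  simp only [Bad, not_not]
  simp only [if_true, Bool.false_eq_true, if_false] at r1 r2
  suffices hs : ((edg v true).filter (fun w => ord w < ord (v lz))).card =
      ((edg v false).filter (fun w => ord w < ord (v lz))).card by omega
  simp only [role, Finset.image_insert, Finset.image_singleton] at h
  have key : ∀ a b c d : ℕ, ({a, b} : Finset ℕ) = {c, d} →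
      (a = c ∨ a = d) ∧ (c = a ∨ c = b) ∧ (b = c ∨ b = d) ∧ (d = a ∨ d = b) := by
    intro a b c d hh
    have e : ∀ x, (x = a ∨ x = b) ↔ (x = c ∨ x = d) := by
      intro x
      have := Finset.ext_iff.1 hh x
      simpa using this
    exact ⟨(e a).1 (Or.inl rfl), (e c).2 (Or.inl rfl), (e b).1 (Or.inr rfl),
      (e d).2 (Or.inr rfl)⟩
  obtain ⟨m1, m2, m3, m4⟩ := key _ _ _ _ h
  rcases lt_or_gt_of_ne hne with hlt | hlt
  · have a1 := rank_lt ord (edg v true) (v lz) (v lz') (mz true _) hlt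
    have a2 := rank_lt ord (edg v false) (v lz) (v lz') (mz false _) hlt
    omega
  · have a1 := rank_lt ord (edg v true) (v lz') (v lz) (mz true _) hlt
    have a2 := rank_lt ord (edg v false) (v lz') (v lz) (mz false _) hlt
    omega

lemma assemble {r m : ℕ} (hr : 3 ≤ r) (hm : r - 2 = m) (i0 : Fin m) (hi0 : (i0 : ℕ) = 0)
    {Ω : Type} (H : Finset Ω) (vert : Ω → Lab m → ℕ) (hv : ∀ ω, Function.Injective (vert ω))
    (M : ℕ) (hM : ∀ ω l, vert ω l < M)
    (hlin : ∀ ω ∈ H, ∀ ω' ∈ H, ω ≠ ω' → ∀ l1 l2 l1' l2', l1 ≠ l2 →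
      vert ω l1 = vert ω' l1' → vert ω l2 = vert ω' l2' → False)
    (hJ : ∀ pos : Lab m → Fin (2 * r - 2), GoodPos i0 pos → ∃ g : ℕ → ℕ, ∀ ω ∈ H, ∀ l l',
      pos l < pos l' → g (vert ω l) < g (vert ω l'))
    (hbad : ∀ ord : ℕ → ℕ, Set.InjOn ord ↑(Finset.range M) →
      ∃ ω ∈ H, Bad (fun l => ord (vert ω l))) :
    ∃ F : RGraph r, QuasiLinear F ∧ ¬ Consistent F ∧
      ∀ σ : Fin (2 * r - 2) → Letter, SeqInconsistent r σ → AdmitsSeq F σ := by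
  classical
  let F : RGraph r :=
    { verts := Finset.range M
      edges := (H ×ˢ Finset.univ).image (fun p : Ω × Bool => edg (vert p.1) p.2)
      edges_subset := by
        intro e he x hx
        rw [Finset.mem_image] at he
        obtain ⟨p, -, rfl⟩ := he
        obtain ⟨l, rfl⟩ := edg_sub _ _ _ hx
        exact Finset.mem_range.2 (hM _ _)
      edges_card := by
        intro e he
        rw [Finset.mem_image] at he
        obtain ⟨p, -, rfl⟩ := he
        rw [edg_card _ (hv _)]; omega }
  have hE : ∀ e, e ∈ F.edges ↔ ∃ ω ∈ H, ∃ b, edg (vert ω) b = e := by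
    intro e
    simp only [F, Finset.mem_image, Finset.mem_product, Finset.mem_univ, and_true, Prod.exists]
    constructor
    · rintro ⟨ω, b, h1, h2⟩; exact ⟨ω, h1, b, h2⟩
    · rintro ⟨ω, h1, b, h2⟩; exact ⟨ω, b, h1, h2⟩
  have hle : ∀ ω ∈ H, ∀ ω' ∈ H, ω ≠ ω' → ∀ b b',
      (edg (vert ω) b ∩ edg (vert ω') b').card ≤ 1 := by
    intro ω hω ω' hω' hne b b'
    rw [Finset.card_le_one]
    intro x hx y hy
    rw [Finset.mem_inter] at hx hy
    obtain ⟨l1, h1⟩ := edg_sub _ _ _ hx.1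
    obtain ⟨l1', h1'⟩ := edg_sub _ _ _ hx.2
    obtain ⟨l2, h2⟩ := edg_sub _ _ _ hy.1
    obtain ⟨l2', h2'⟩ := edg_sub _ _ _ hy.2
    by_contra hxy
    refine hlin ω hω ω' hω' hne l1 l2 l1' l2' ?_ (h1.trans h1'.symm) (h2.trans h2'.symm)
    rintro rfl
    exact hxy (h1.symm.trans h2)
  have hnee : ∀ ω b, edg (vert ω) (!b) ≠ edg (vert ω) b := by
    intro ω b h
    have h1 := edg_inter_card (vert ω) (hv ω) b
    rw [h, Finset.inter_self, edg_card _ (hv ω)] at h1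
    omega
  have htw : ∀ e f, IsTwin F e f → ∃ ω ∈ H, ∃ b, e = edg (vert ω) b ∧ f = edg (vert ω) (!b) := by
    rintro e f ⟨he, hf, hef, hc⟩
    obtain ⟨ω, hω, b, rfl⟩ := (hE e).1 he
    obtain ⟨ω', hω', b', rfl⟩ := (hE f).1 hf
    have hωω : ω = ω' := by
      by_contra hne
      have := hle ω hω ω' hω' hne b b'
      omega
    subst hωω
    refine ⟨ω, hω, b, rfl, ?_⟩
    have : b' = !b := by
      cases b <;> cases b' <;> first | rfl | exact absurd rfl hef
    rw [this]
  refine ⟨F, ?_, ?_, ?_⟩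
  · intro e he
    obtain ⟨ω, hω, b, rfl⟩ := (hE e).1 he
    refine ⟨edg (vert ω) (!b), (hE _).2 ⟨ω, hω, _, rfl⟩, hnee ω b,
      edg_inter_card _ (hv ω) b, ?_⟩
    intro f' hf' h1 h2
    obtain ⟨ω', hω', b', rfl⟩ := (hE f').1 hf'
    by_cases hne : ω = ω'
    · subst hne
      cases b <;> cases b' <;> first | exact absurd rfl h1 | exact absurd rfl h2
    · exact hle ω hω ω' hω' hne b b'
  · rintro ⟨ord, hinj, hcons⟩
    obtain ⟨ω, hω, hb⟩ := hbad ord hinj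
    refine not_bad_of_role (vert ω) (hv ω) ord ?_ ?_ hb
    · intro h
      have := hinj (Finset.mem_coe.2 (Finset.mem_range.2 (hM ω lz)))
        (Finset.mem_coe.2 (Finset.mem_range.2 (hM ω lz'))) h
      simpa using hv ω this
    · exact hcons _ _ ⟨(hE _).2 ⟨ω, hω, _, rfl⟩, (hE _).2 ⟨ω, hω, _, rfl⟩, (hnee ω false),
        edg_inter_card _ (hv ω) true⟩
  · intro σ hσ
    obtain ⟨pos, hgood, hσz, hσxy⟩ := pos_of_inconsistent hm i0 hi0 σ hσ
    obtain ⟨g, hg⟩ := hJ pos hgood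
    have hbij : Function.Bijective pos := by
      rw [Fintype.bijective_iff_injective_and_card]
      refine ⟨hgood.1, ?_⟩
      simp; omega
    let q := Equiv.ofBijective pos hbij
    have hq : ∀ i, pos (q.symm i) = i := fun i => Equiv.ofBijective_apply_symm_apply pos hbij i
    refine ⟨fun v => g v * M + v, ?_, ?_⟩
    · intro u hu v hv' h
      have hu' : u < M := Finset.mem_range.1 hu
      have hv'' : v < M := Finset.mem_range.1 hv'
      have h' := congrArg (· % M) h
      simpa [Nat.mul_add_mod_self_right, Nat.mod_eq_of_lt hu', Nat.mod_eq_of_lt hv''] using h'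
    · intro e f hef
      obtain ⟨ω, hω, b, rfl, rfl⟩ := htw e f hef
      have hpt : ∀ i, (∀ j, q.symm i ≠ lx j) ∨ (∀ j, q.symm i ≠ ly j) := by
        intro i
        by_contra hno
        push Not at hno
        obtain ⟨⟨j, h1⟩, ⟨j', h2⟩⟩ := hno
        rw [h1] at h2; simp at h2
      refine ⟨fun i => vert ω (q.symm i), ?_, ?_, ?_⟩
      · intro i j hij
        have h1 := hg ω hω (q.symm i) (q.symm j) (by rwa [hq, hq])
        have h2 := hM ω (q.symm i)
        dsimp only
        nlinarith
      · intro x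
        rw [Finset.mem_union]
        constructor
        · intro hx
          have : ∃ l, vert ω l = x := by
            rcases hx with hx | hx <;> exact edg_sub _ _ _ hx
          obtain ⟨l, rfl⟩ := this
          exact ⟨q l, by simp⟩
        · rintro ⟨i, rfl⟩
          rw [mem_edg _ (hv ω), mem_edg _ (hv ω)]
          have := hpt i
          cases b
          · simpa using this
          · simpa using this.symm
      · have key : ∀ i (b : Bool), vert ω (q.symm i) ∈ edg (vert ω) b ↔
            ∀ j, q.symm i ≠ if b then ly j else lx j := fun i b => mem_edg _ (hv ω) _ _
        have kx : ∀ i, vert ω (q.symm i) ∈ edg (vert ω) true ↔ σ i ≠ σ (pos (ly i0)) := by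
          intro i
          rw [key, ← hq i, show q.symm (pos (q.symm i)) = q.symm i by rw [hq]]
          generalize q.symm i = l
          rcases l with j | j | c <;> rcases hσxy with ⟨h1, h2⟩ | ⟨h1, h2⟩ <;> simp [h1, h2, hσz]
        have ky : ∀ i, vert ω (q.symm i) ∈ edg (vert ω) false ↔ σ i ≠ σ (pos (lx i0)) := by
          intro i
          rw [key, ← hq i, show q.symm (pos (q.symm i)) = q.symm i by rw [hq]]
          generalize q.symm i = l
          rcases l with j | j | c <;> rcases hσxy with ⟨h1, h2⟩ | ⟨h1, h2⟩ <;> simp [h1, h2, hσz]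
        rcases hσxy with ⟨h1, h2⟩ | ⟨h1, h2⟩ <;> rw [h1] at ky <;> rw [h2] at kx <;> cases b
        · exact Or.inr ⟨ky, kx⟩
        · exact Or.inl ⟨kx, ky⟩
        · exact Or.inl ⟨ky, kx⟩
        · exact Or.inr ⟨kx, ky⟩

lemma main_aux (r : ℕ) (hr : 3 ≤ r) :
    ∃ F : RGraph r, QuasiLinear F ∧ ¬ Consistent F ∧
      ∀ σ : Fin (2 * r - 2) → Letter, SeqInconsistent r σ → AdmitsSeq F σ := by
  classical
  obtain ⟨m, hm⟩ : ∃ m, r - 2 = m := ⟨_, rfl⟩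
  let i0 : Fin m := ⟨0, by omega⟩
  let J := {pos : Lab m → Fin (2 * r - 2) // GoodPos i0 pos}
  haveI : Nonempty J := by
    obtain ⟨p, hp⟩ := exists_goodPos hr hm i0
    exact ⟨⟨p, hp⟩⟩
  obtain ⟨k, hk⟩ : ∃ k : ℤ, k = ((2 * r - 2 : ℕ) : ℤ) := ⟨_, rfl⟩
  obtain ⟨B, hB⟩ : ∃ B : ℤ, B = k * k + 4 * k := ⟨_, rfl⟩
  let box : Finset (J → ℤ) := Fintype.piFinset (fun _ => Finset.Icc (-B) B)
  have hbox : ∀ a, a ∈ box ↔ ∀ j, -B ≤ a j ∧ a j ≤ B := by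
    intro a; simp [box, Fintype.mem_piFinset]
  let A := {a : J → ℤ // a ∈ box}
  let Cp (c : Lab m → A) : Prop := ∀ (j : J) l l', j.1 l < j.1 l' → (c l).1 j < (c l').1 j
  have hCp : ∀ c, Cp c → Function.Injective c := by
    intro c hc l l' h
    obtain ⟨j⟩ := ‹Nonempty J›
    by_contra hne
    rcases lt_or_gt_of_ne (fun h' => hne (j.2.1 h') : j.1 l ≠ j.1 l') with h1 | h1
    · have := hc j _ _ h1; rw [h] at this; exact lt_irrefl _ this
    · have := hc j _ _ h1; rw [h] at this; exact lt_irrefl _ this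
  have hbase : ∀ ord : A → ℕ, Function.Injective ord → ∃ c, Cp c ∧ Bad (fun l => ord (c l)) := by
    intro ord hord
    obtain ⟨c, hc1, hc2, hc3⟩ := base_aux (J := J) (fun j l => ((j.1 l : ℕ) : ℤ)) k
      (fun j l => by positivity) (fun j l => by have := (j.1 l).2; omega)
      (fun j l l' h => j.2.1 (Fin.ext (by dsimp only at h; exact_mod_cast h))) i0
      (fun j => by have := j.2.2.1; rw [Fin.lt_def] at this; exact_mod_cast this)
      (fun j => by have := j.2.2.2.1; rw [Fin.lt_def] at this; exact_mod_cast this)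
      (fun j i h => by
        have := j.2.2.2.2 i (by rw [Fin.lt_def]; exact_mod_cast h)
        rw [Fin.lt_def] at this; exact_mod_cast this)
      (fun a => if h : a ∈ box then ord ⟨a, h⟩ else 0) B hB (by
        intro a ha b hb h
        have ha' := (hbox a).2 ha
        have hb' := (hbox b).2 hb
        simp only [dif_pos ha', dif_pos hb'] at h
        exact congrArg Subtype.val (hord h))
    refine ⟨fun l => ⟨c l, (hbox _).2 (hc1 l)⟩, ?_, ?_⟩
    · intro j l l' h
      exact hc2 j l l' (by rw [Fin.lt_def] at h; exact_mod_cast h)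
    · have : ∀ l, c l ∈ box := fun l => (hbox _).2 (hc1 l)
      simpa only [dif_pos (this _)] using hc3
  haveI : Nonempty (Lab m) := ⟨lz⟩
  obtain ⟨n, H, hH1, hH2⟩ := sparse Cp hCp Bad hbase
  let M := Fintype.card (A × Fin n)
  have hMc : M = Fintype.card A * n := by simp [M]
  let q : A × Fin n ≃ Fin M := Fintype.equivFin _
  have hqi : ∀ u v, (q u : ℕ) = q v → u = v := fun u v h => q.injective (Fin.ext h)
  refine assemble hr hm i0 rfl H (fun ω l => (q (ω.1.1 l, ω.2 l) : ℕ)) ?_ M (fun ω l => (q _).2)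
    ?_ ?_ ?_
  · intro ω l l' h
    exact hCp _ ω.1.2 (congrArg Prod.fst (hqi _ _ h))
  · intro ω hω ω' hω' hne l1 l2 l1' l2' hl e1 e2
    exact hH1 ω hω ω' hω' hne l1 l2 l1' l2' hl (hqi _ _ e1) (hqi _ _ e2)
  · intro pos hpos
    refine ⟨fun v => if h : v < M then ((q.symm ⟨v, h⟩).1.1 ⟨pos, hpos⟩ + B).toNat else 0, ?_⟩
    intro ω hω l l' hl
    have h1 := ω.1.2 ⟨pos, hpos⟩ l l' hl
    have h2 := (hbox _).1 (ω.1.1 l).2 ⟨pos, hpos⟩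
    simp only [Fin.is_lt, dif_pos, Fin.eta, Equiv.symm_apply_apply]
    omega
  · intro ord hord
    have hinj : ∀ u v, ord (q u) = ord (q v) → u = v := fun u v h =>
      hqi _ _ (hord (Finset.mem_coe.2 (Finset.mem_range.2 (q u).2))
        (Finset.mem_coe.2 (Finset.mem_range.2 (q v).2)) h)
    let t (v : A × Fin n) : ℕ := (Finset.univ.filter (fun u => ord (q u) < ord (q v))).card
    have ht1 : ∀ u v, ord (q u) < ord (q v) → t u < t v := by
      intro u v h
      apply Finset.card_lt_card
      rw [Finset.ssubset_iff_of_subset]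
      · exact ⟨u, by simp [h], by simp⟩
      · intro w hw
        simp only [Finset.mem_filter, Finset.mem_univ, true_and] at hw ⊢
        exact hw.trans h
    have ht2 : ∀ u v, t u < t v ↔ ord (q u) < ord (q v) := by
      intro u v
      refine ⟨fun h => ?_, ht1 u v⟩
      by_contra hn
      rcases (not_lt.1 hn).lt_or_eq with h' | h'
      · have := ht1 _ _ h'; omega
      · rw [hinj _ _ h'] at h; omega
    obtain ⟨ω, hω, hb⟩ := hH2 t (by
      intro u v h
      by_contra hne
      rcases lt_or_gt_of_ne (fun h' => hne (hinj _ _ h') : ord (q u) ≠ ord (q v)) with h' | h'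
      · have := ht1 _ _ h'; omega
      · have := ht1 _ _ h'; omega) (by
      intro v
      rw [← hMc]
      apply Finset.card_lt_univ_of_notMem (x := v)
      simp)
    refine ⟨ω, hω, ?_⟩
    simpa only [Bad, ht2] using hb

/-- existence of a quasi-linear, inconsistent r-graph admitting all
inconsistent descriptive sequences of order r. -/
theorem exists_quasiLinear_inconsistent (r : ℕ) (hr : 3 ≤ r) :
    ∃ F : RGraph r, QuasiLinear F ∧ ¬ Consistent F ∧
      ∀ σ : Fin (2 * r - 2) → Letter, SeqInconsistent r σ → AdmitsSeq F σ := by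
  exact main_aux r hr

end UTD
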